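/- Let n be a positive integer and let x ∈ (a,b) with 1/n ≤ a < b < ∞, and set α = ⌊na⌋/n and β = ⌈nb⌉/n. Suppose f, ℓ : [0,∞) → ℝ are functions such that ℓ is affine, f(t) = ℓ(t) for all t ∈ (a,b), and ‖f − ℓ‖ := sup_{t ≥ 0}|f(t) − ℓ(t)| < ∞. Then |S_n f(x) − f(x)| ≤ ‖f − ℓ‖·( L_n(x,α)·exp(−n·H(α,x)) + R_n(x,β)·exp(−n·H(β,x)) ). -/

import Mathlib

open Real

/-- Poisson probability mass function with mean `lam`: `P(N_lam = k)`. -/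
noncomputable def poissonProb (lam : ℝ) (k : ℕ) : ℝ := lam ^ k * Real.exp (-lam) / k.factorial

/-- Kullback–Leibler divergence between Poisson random variables with means `t` and `x`. -/
noncomputable def H (t x : ℝ) : ℝ := t * Real.log (t / x) - t + x

/-- The Szász–Mirakyan operator: `S_n f x = E f(N_{nx}/n)`. -/
noncomputable def szasz (n : ℕ) (f : ℝ → ℝ) (x : ℝ) : ℝ :=
  ∑' k : ℕ, f ((k : ℝ) / n) * poissonProb ((n : ℝ) * x) k

/-- `L_n(x,α)` from the left-tail bound. -/
noncomputable def Ln (n : ℕ) (x α : ℝ) : ℝ :=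
  min (x / ((x - α + 1 / n) * Real.sqrt (2 * π * n * α))) (1 / 2) + 1 / Real.sqrt (2 * π * n * α)

/-- `R_n(x,β)` from the right-tail bound. -/
noncomputable def Rn (n : ℕ) (x β : ℝ) : ℝ :=
  min (x / ((β - x + 1 / n) * Real.sqrt (2 * π * n * β))) (1 / 2) + 1 / Real.sqrt (2 * π * n * β)

lemma poissonProb_nonneg {lam : ℝ} (hlam : 0 ≤ lam) (k : ℕ) : 0 ≤ poissonProb lam k := by
  unfold poissonProb; positivity

lemma poissonProb_succ (lam : ℝ) (k : ℕ) :
    ((k : ℝ) + 1) * poissonProb lam (k + 1) = lam * poissonProb lam k := by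
  unfold poissonProb
  rw [Nat.factorial_succ]
  push_cast
  field_simp
  ring

lemma hasSum_poissonProb (lam : ℝ) : HasSum (poissonProb lam) 1 := by
  have h := (NormedSpace.expSeries_div_hasSum_exp lam).mul_left (Real.exp (-lam))
  rw [← Real.exp_eq_exp_ℝ, ← Real.exp_add, neg_add_cancel, Real.exp_zero] at h
  convert! h using 2 with k
  unfold poissonProb
  ring

lemma hasSum_natCast_mul_poissonProb (lam : ℝ) :
    HasSum (fun k : ℕ => (k : ℝ) * poissonProb lam k) lam := by
  rw [← hasSum_nat_add_iff' 1]
  have h := (hasSum_poissonProb lam).mul_left lam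
  simp_rw [← poissonProb_succ, mul_one] at h
  simpa using h

lemma sum_poissonProb_le_one {lam : ℝ} (hlam : 0 ≤ lam) (m : ℕ) :
    ∑ k ∈ Finset.range m, poissonProb lam k ≤ 1 :=
  sum_le_hasSum _ (fun k _ => poissonProb_nonneg hlam k) (hasSum_poissonProb lam)

lemma sum_add_tsum_poissonProb (lam : ℝ) (m : ℕ) :
    ∑ k ∈ Finset.range m, poissonProb lam k + ∑' k, poissonProb lam (k + m) = 1 :=
  ((hasSum_poissonProb lam).summable.sum_add_tsum_nat_add m).trans (hasSum_poissonProb lam).tsum_eq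

lemma summable_poissonProb_add (lam : ℝ) (m : ℕ) :
    Summable fun k => poissonProb lam (k + m) :=
  (summable_nat_add_iff m).2 (hasSum_poissonProb lam).summable

/-- Change of mean for Poisson probabilities. -/
lemma poissonProb_eq_mul_of_pos {lam μ : ℝ} (hμ : 0 < μ) (k : ℕ) :
    poissonProb lam k = poissonProb μ k * ((lam / μ) ^ k * Real.exp (μ - lam)) := by
  unfold poissonProb
  have h : Real.exp (-lam) = Real.exp (-μ) * Real.exp (μ - lam) := by
    rw [← Real.exp_add]; ring_nf
  rw [h, div_pow]
  field_simp

lemma pow_mul_exp_eq_exp_neg_H {lam : ℝ} (hlam : 0 < lam) {m : ℕ} (hm : 0 < m) :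
    (lam / m) ^ m * Real.exp (m - lam) = Real.exp (-H m lam) := by
  have hm' : (0 : ℝ) < m := by exact_mod_cast hm
  rw [← Real.exp_log (show 0 < (lam / m) ^ m by positivity), ← Real.exp_add, Real.log_pow,
    Real.log_div hlam.ne' hm'.ne', H, Real.log_div hm'.ne' hlam.ne']
  ring_nf

lemma poissonProb_self_le {m : ℕ} (hm : 0 < m) :
    poissonProb m m ≤ 1 / Real.sqrt (2 * π * m) := by
  have hm' : (0 : ℝ) < m := by exact_mod_cast hm
  have h := Stirling.le_factorial_stirling m
  rw [poissonProb, div_le_div_iff₀ (by positivity) (by positivity), one_mul]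
  refine le_trans (le_of_eq ?_) h
  rw [div_pow, ← Real.exp_nat_mul, mul_one, Real.exp_neg]
  ring

lemma poissonProb_le_exp_neg_H {lam : ℝ} (hlam : 0 < lam) {m : ℕ} (hm : 0 < m) :
    poissonProb lam m ≤ 1 / Real.sqrt (2 * π * m) * Real.exp (-H m lam) := by
  rw [poissonProb_eq_mul_of_pos (show (0 : ℝ) < m by exact_mod_cast hm),
    pow_mul_exp_eq_exp_neg_H hlam hm]
  gcongr
  exact poissonProb_self_le hm

lemma poissonProb_le_of_le_of_le {lam : ℝ} {m k : ℕ} (hm : 0 < m) (hlam : (m : ℝ) ≤ lam)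
    (hk : k ≤ m) : poissonProb lam k ≤ poissonProb m k * Real.exp (-H m lam) := by
  have hm' : (0 : ℝ) < m := by exact_mod_cast hm
  rw [poissonProb_eq_mul_of_pos hm', ← pow_mul_exp_eq_exp_neg_H (hm'.trans_le hlam) hm]
  have := poissonProb_nonneg hm'.le k
  have : 1 ≤ lam / m := (one_le_div hm').2 hlam
  gcongr

lemma poissonProb_le_of_ge_of_ge {lam : ℝ} {m k : ℕ} (hlam : 0 < lam) (hm : lam ≤ m)
    (hk : m ≤ k) : poissonProb lam k ≤ poissonProb m k * Real.exp (-H m lam) := by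
  have hm' : (0 : ℝ) < m := hlam.trans_le hm
  rw [poissonProb_eq_mul_of_pos hm', ← pow_mul_exp_eq_exp_neg_H hlam (by exact_mod_cast hm')]
  have := poissonProb_nonneg hm'.le k
  refine mul_le_mul_of_nonneg_left ?_ this
  refine mul_le_mul_of_nonneg_right ?_ (Real.exp_pos _).le
  exact pow_le_pow_of_le_one (by positivity) ((div_le_one hm').2 hm) hk

lemma poissonProb_pred_sub_le_add {m i : ℕ} (hi : i < m) :
    poissonProb m (m - 1 - i) ≤ poissonProb m (m + i) := by
  have hm : (0 : ℝ) < m := by exact_mod_cast (Nat.zero_le i).trans_lt hi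
  induction i with
  | zero =>
    have h := poissonProb_succ m (m - 1)
    obtain ⟨j, rfl⟩ : ∃ j, m = j + 1 := ⟨m - 1, by omega⟩
    simp only [Nat.add_sub_cancel, Nat.cast_add, Nat.cast_one, Nat.sub_zero, Nat.add_zero] at h hm ⊢
    exact (mul_left_cancel₀ hm.ne' h).ge
  | succ i ih =>
    obtain ⟨j, rfl⟩ : ∃ j, m = i + 1 + (j + 1) := ⟨m - (i + 1) - 1, by omega⟩
    have ih := ih (by omega)
    have h1 := poissonProb_succ ((i + 1 + (j + 1) : ℕ) : ℝ) j
    have h2 := poissonProb_succ ((i + 1 + (j + 1) : ℕ) : ℝ) (i + 1 + (j + 1) + i)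
    rw [show i + 1 + (j + 1) - 1 - i = j + 1 by omega] at ih
    rw [show i + 1 + (j + 1) - 1 - (i + 1) = j by omega, ← add_assoc]
    have h0 := poissonProb_nonneg hm.le (i + 1 + (j + 1) + i)
    set M : ℝ := ((i + 1 + (j + 1) : ℕ) : ℝ) with hM
    have hMe : M = i + 1 + (j + 1) := by rw [hM]; push_cast; ring
    rw [show ((i + 1 + (j + 1) + i : ℕ) : ℝ) = M + i by rw [hM]; push_cast; ring] at h2
    have hi0 : (0 : ℝ) ≤ i := Nat.cast_nonneg i
    have hj0 : (0 : ℝ) ≤ j := Nat.cast_nonneg j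
    have hc : (0 : ℝ) < M * (M + i + 1) := by positivity
    refine le_of_mul_le_mul_left ?_ hc
    calc M * (M + i + 1) * poissonProb M j
        = (M + i + 1) * ((j + 1) * poissonProb M (j + 1)) := by rw [h1]; ring
      _ ≤ (M + i + 1) * ((j + 1) * poissonProb M (i + 1 + (j + 1) + i)) := by gcongr
      _ = ((M + i + 1) * (j + 1)) * poissonProb M (i + 1 + (j + 1) + i) := by ring
      _ ≤ (M * M) * poissonProb M (i + 1 + (j + 1) + i) := by
        refine mul_le_mul_of_nonneg_right ?_ h0
        have : (j : ℝ) + 1 = M - (i + 1) := by rw [hMe]; ring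
        rw [this]
        nlinarith [sq_nonneg ((i : ℝ) + 1)]
      _ = M * (M + i + 1) * poissonProb M (i + 1 + (j + 1) + i + 1) := by
        rw [mul_assoc M (M + i + 1), h2]; ring

lemma sum_range_poissonProb_self_le_half (m : ℕ) :
    ∑ k ∈ Finset.range m, poissonProb m k ≤ 1 / 2 := by
  have h1 : ∑ k ∈ Finset.range m, poissonProb m k
      ≤ ∑ i ∈ Finset.range m, poissonProb m (m + i) := by
    rw [← Finset.sum_range_reflect]
    exact Finset.sum_le_sum fun i hi => poissonProb_pred_sub_le_add (Finset.mem_range.1 hi)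
  have h2 := sum_poissonProb_le_one (Nat.cast_nonneg (α := ℝ) m) (m + m)
  rw [Finset.sum_range_add] at h2
  linarith

lemma hasDerivAt_sum_range_poissonProb (m : ℕ) (lam : ℝ) :
    HasDerivAt (fun t => ∑ k ∈ Finset.range (m + 1), poissonProb t k) (-poissonProb lam m) lam := by
  induction m with
  | zero =>
    simpa [poissonProb] using (hasDerivAt_neg lam).exp
  | succ m ih =>
    simp_rw [Finset.sum_range_succ _ (m + 1)]
    have h : HasDerivAt (fun t => poissonProb t (m + 1))
        (poissonProb lam m - poissonProb lam (m + 1)) lam := by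
      have := ((hasDerivAt_pow (m + 1) lam).mul (hasDerivAt_neg lam).exp).div_const
        ((m + 1).factorial : ℝ)
      refine this.congr_deriv ?_
      unfold poissonProb
      rw [Nat.factorial_succ]
      push_cast
      field_simp
      ring
    exact (ih.add h).congr_deriv (by ring)

lemma exp_two_mul_mul_one_sub_le {u : ℝ} (h0 : 0 ≤ u) (h1 : u < 1) :
    Real.exp (2 * u) * (1 - u) ≤ 1 + u := by
  have h := Real.sum_range_le_log_div h0 h1 1
  simp only [Finset.range_one, Finset.sum_singleton, Nat.cast_zero, mul_zero, zero_add, pow_one,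
    div_one] at h
  have h' : 2 * u ≤ Real.log ((1 + u) / (1 - u)) := by linarith
  rwa [Real.le_log_iff_exp_le (div_pos (by linarith) (by linarith)),
    le_div_iff₀ (by linarith)] at h'

lemma poissonProb_sub_le_poissonProb_add {m : ℕ} {s : ℝ} (h0 : 0 ≤ s) (h1 : s < m) :
    poissonProb (m - s) m ≤ poissonProb (m + s) m := by
  have hm : (0 : ℝ) < m := h0.trans_lt h1
  have hu := exp_two_mul_mul_one_sub_le (u := s / m) (by positivity) ((div_lt_one hm).2 h1)
  have hbase : Real.exp (2 * (s / m)) * (m - s) ≤ m + s := by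
    have := mul_le_mul_of_nonneg_left hu hm.le
    calc _ = m * (Real.exp (2 * (s / m)) * (1 - s / m)) := by field_simp
      _ ≤ m * (1 + s / m) := this
      _ = m + s := by field_simp
  have hpow : Real.exp (2 * s) * (m - s) ^ m ≤ (m + s) ^ m := by
    have := pow_le_pow_left₀ (mul_nonneg (Real.exp_pos _).le (by linarith)) hbase m
    rwa [mul_pow, ← Real.exp_nat_mul, show (m : ℝ) * (2 * (s / m)) = 2 * s by field_simp] at this
  unfold poissonProb
  gcongr ?_ / _
  calc (m - s) ^ m * Real.exp (-(m - s))
      = Real.exp (2 * s) * (m - s) ^ m * Real.exp (-(m + s)) := by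
        rw [show -((m : ℝ) - s) = 2 * s + -(m + s) by ring, Real.exp_add]; ring
    _ ≤ (m + s) ^ m * Real.exp (-(m + s)) := by gcongr

lemma half_le_sum_range_succ_poissonProb_self (m : ℕ) :
    1 / 2 ≤ ∑ k ∈ Finset.range (m + 1), poissonProb m k := by
  set q : ℝ → ℝ := fun t => ∑ k ∈ Finset.range (m + 1), poissonProb t k with hq
  have hd (s : ℝ) : HasDerivAt (fun s => q (m - s) + q (m + s))
      (poissonProb (m - s) m - poissonProb (m + s) m) s := by
    have h1 := (hasDerivAt_sum_range_poissonProb m (m - s)).comp s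
      ((hasDerivAt_id s).const_sub (m : ℝ))
    have h2 := (hasDerivAt_sum_range_poissonProb m (m + s)).comp s
      ((hasDerivAt_id s).const_add (m : ℝ))
    exact (h1.add h2).congr_deriv (by ring)
  have hanti : AntitoneOn (fun s => q (m - s) + q (m + s)) (Set.Icc 0 m) := by
    refine antitoneOn_of_deriv_nonpos (convex_Icc _ _)
      (fun s _ => (hd s).continuousAt.continuousWithinAt)
      (fun s _ => (hd s).differentiableAt.differentiableWithinAt) fun s hs => ?_
    rw [interior_Icc] at hs
    rw [(hd s).deriv]
    exact sub_nonpos.2 (poissonProb_sub_le_poissonProb_add hs.1.le hs.2)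
  have hm : (0 : ℝ) ≤ m := Nat.cast_nonneg m
  have h := hanti (Set.left_mem_Icc.2 hm) (Set.right_mem_Icc.2 hm) hm
  simp only [sub_zero, add_zero, sub_self] at h
  have hq0 : q 0 = 1 := by
    simp [hq, Finset.sum_range_succ', poissonProb]
  have hq1 : 0 ≤ q (m + m) := Finset.sum_nonneg fun k _ => poissonProb_nonneg (by positivity) k
  change 1 / 2 ≤ q m
  linarith

lemma tsum_poissonProb_self_le_half (m : ℕ) : ∑' k, poissonProb m (k + (m + 1)) ≤ 1 / 2 := by
  have h1 := sum_add_tsum_poissonProb m (m + 1)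
  have h2 := half_le_sum_range_succ_poissonProb_self m
  linarith

lemma mul_sum_range_poissonProb_le (lam : ℝ) (hlam : 0 ≤ lam) (m : ℕ) :
    (lam - m + 1) * ∑ k ∈ Finset.range m, poissonProb lam k ≤ m * poissonProb lam m := by
  induction m with
  | zero => simp
  | succ m ih =>
    have h : 0 ≤ ∑ k ∈ Finset.range m, poissonProb lam k :=
      Finset.sum_nonneg fun k _ => poissonProb_nonneg hlam k
    rw [Finset.sum_range_succ]
    push_cast
    rw [poissonProb_succ]
    nlinarith

lemma mul_tsum_poissonProb_le (lam : ℝ) (hlam : 0 ≤ lam) (m : ℕ) :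
    (m - lam + 1) * ∑' k, poissonProb lam (k + (m + 1)) ≤ lam * poissonProb lam m := by
  have h1 : ((m : ℝ) + 1) * ∑' k, poissonProb lam (k + (m + 1))
      ≤ lam * ∑' k, poissonProb lam (k + m) := by
    rw [← tsum_mul_left, ← tsum_mul_left]
    refine Summable.tsum_le_tsum (fun k => ?_) ((summable_poissonProb_add lam _).mul_left _)
      ((summable_poissonProb_add lam _).mul_left _)
    rw [← poissonProb_succ, ← add_assoc]
    have := poissonProb_nonneg hlam (k + m + 1)
    gcongr
    simp
  have h2 : ∑' k, poissonProb lam (k + m)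
      = poissonProb lam m + ∑' k, poissonProb lam (k + (m + 1)) := by
    have := sum_add_tsum_poissonProb lam m
    have := sum_add_tsum_poissonProb lam (m + 1)
    rw [Finset.sum_range_succ] at this
    linarith
  rw [h2] at h1
  linarith

lemma le_mul_div_mul_exp {T c p lam r E : ℝ} (hc : 0 < c) (hlam : 0 ≤ lam)
    (hT : c * T ≤ lam * p) (hp : p ≤ 1 / r * E) : T ≤ lam / (c * r) * E := by
  rw [← le_div_iff₀' hc] at hT
  calc T ≤ lam * p / c := hT
    _ ≤ lam * (1 / r * E) / c := by gcongr
    _ = lam / (c * r) * E := by ring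

/-- Left-tail bound for the Poisson distribution. -/
lemma sum_range_succ_poissonProb_le {lam : ℝ} {m : ℕ} (hm : 0 < m) (hlam : (m : ℝ) < lam) :
    ∑ k ∈ Finset.range (m + 1), poissonProb lam k ≤ Ln 1 lam m * Real.exp (-H m lam) := by
  have hm' : (0 : ℝ) < m := by exact_mod_cast hm
  have hlam0 := hm'.trans hlam
  have hp := poissonProb_le_exp_neg_H hlam0 hm
  rw [Finset.sum_range_succ, Ln, add_mul, min_mul_of_nonneg _ _ (Real.exp_pos _).le]
  simp only [Nat.cast_one, mul_one, div_one]
  refine add_le_add (le_min ?_ ?_) hp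
  · refine le_mul_div_mul_exp (by linarith) hlam0.le ?_ hp
    refine (mul_sum_range_poissonProb_le lam hlam0.le m).trans ?_
    have := poissonProb_nonneg hlam0.le m
    gcongr
  · calc ∑ k ∈ Finset.range m, poissonProb lam k
        ≤ ∑ k ∈ Finset.range m, poissonProb m k * Real.exp (-H m lam) :=
          Finset.sum_le_sum fun k hk =>
            poissonProb_le_of_le_of_le hm hlam.le (Finset.mem_range.1 hk).le
      _ = (∑ k ∈ Finset.range m, poissonProb m k) * Real.exp (-H m lam) := by
          rw [Finset.sum_mul]
      _ ≤ 1 / 2 * Real.exp (-H m lam) := by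
          gcongr
          exact sum_range_poissonProb_self_le_half m

/-- Right-tail bound for the Poisson distribution. -/
lemma tsum_poissonProb_add_le {lam : ℝ} {m : ℕ} (hlam0 : 0 < lam) (hlam : lam < m) :
    ∑' k, poissonProb lam (k + m) ≤ Rn 1 lam m * Real.exp (-H m lam) := by
  have hm : 0 < m := by exact_mod_cast hlam0.trans hlam
  have hp := poissonProb_le_exp_neg_H hlam0 hm
  have hsplit : ∑' k, poissonProb lam (k + m)
      = ∑' k, poissonProb lam (k + (m + 1)) + poissonProb lam m := by
    rw [(summable_poissonProb_add lam m).tsum_eq_zero_add, zero_add, add_comm]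
    simp only [add_right_comm _ 1 m, add_assoc]
  rw [hsplit, Rn, add_mul, min_mul_of_nonneg _ _ (Real.exp_pos _).le]
  simp only [Nat.cast_one, mul_one, div_one]
  refine add_le_add (le_min ?_ ?_) hp
  · exact le_mul_div_mul_exp (by linarith) hlam0.le (mul_tsum_poissonProb_le lam hlam0.le m) hp
  · calc ∑' k, poissonProb lam (k + (m + 1))
        ≤ ∑' k, poissonProb m (k + (m + 1)) * Real.exp (-H m lam) :=
          (summable_poissonProb_add lam _).tsum_le_tsum
            (fun k => poissonProb_le_of_ge_of_ge hlam0 hlam.le (by omega))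
            ((summable_poissonProb_add _ _).mul_right _)
      _ = (∑' k, poissonProb m (k + (m + 1))) * Real.exp (-H m lam) := by
          rw [tsum_mul_right]
      _ ≤ 1 / 2 * Real.exp (-H m lam) := by
          gcongr
          exact tsum_poissonProb_self_le_half m

lemma mul_H_div {n : ℕ} (hn : 0 < n) (m x : ℝ) : (n : ℝ) * H (m / n) x = H m (n * x) := by
  have hn' : (n : ℝ) ≠ 0 := by exact_mod_cast hn.ne'
  unfold H
  rw [div_div]
  field_simp

lemma Ln_div {n : ℕ} (hn : 0 < n) (x m : ℝ) : Ln n x (m / n) = Ln 1 (n * x) m := by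
  have hn' : (n : ℝ) ≠ 0 := by exact_mod_cast hn.ne'
  have h1 : 2 * π * n * (m / n) = 2 * π * m := by field_simp
  have h2 : n * x - m + 1 = n * (x - m / n + 1 / n) := by field_simp
  unfold Ln
  rw [h1, Nat.cast_one, mul_one, div_one, h2, mul_assoc (n : ℝ), mul_div_mul_left _ _ hn']

lemma Rn_div {n : ℕ} (hn : 0 < n) (x m : ℝ) : Rn n x (m / n) = Rn 1 (n * x) m := by
  have hn0 : (n : ℝ) ≠ 0 := by exact_mod_cast hn.ne'
  have h1 : 2 * π * n * (m / n) = 2 * π * m := by field_simp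
  have h2 : m - n * x + 1 = n * (m / n - x + 1 / n) := by field_simp
  unfold Rn
  rw [h1, Nat.cast_one, mul_one, div_one, h2, mul_assoc (n : ℝ), mul_div_mul_left _ _ hn0]

/-- The Szász–Mirakyan operator reproduces affine functions. -/
lemma hasSum_affine_mul_poissonProb {n : ℕ} (hn : 0 < n) (c d x : ℝ) :
    HasSum (fun k : ℕ => (c * ((k : ℝ) / n) + d) * poissonProb (n * x) k) (c * x + d) := by
  have hn' : (n : ℝ) ≠ 0 := by exact_mod_cast hn.ne'
  have h := ((hasSum_natCast_mul_poissonProb (n * x)).mul_left (c / n)).add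
    ((hasSum_poissonProb (n * x)).mul_left d)
  convert! h using 1
  · ext k
    ring
  · field_simp

/-- A bounded function vanishing strictly between `A` and `B` has small Poisson expectation. -/
lemma summable_and_abs_tsum_mul_poissonProb_le {lam M : ℝ} (hlam : 0 ≤ lam) {A B : ℕ} {g : ℕ → ℝ}
    (hg : ∀ k, |g k| ≤ M) (hg0 : ∀ k, A < k → k < B → g k = 0) :
    (Summable fun k => g k * poissonProb lam k) ∧
      |∑' k, g k * poissonProb lam k| ≤
        M * (∑ k ∈ Finset.range (A + 1), poissonProb lam k + ∑' k, poissonProb lam (k + B)) := by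
  have hM : 0 ≤ M := (abs_nonneg _).trans (hg 0)
  have hL : HasSum (fun k => if k ∈ Finset.range (A + 1) then poissonProb lam k else 0)
      (∑ k ∈ Finset.range (A + 1), poissonProb lam k) := by
    rw [← Finset.sum_congr rfl fun k hk => if_pos hk]
    exact hasSum_sum_of_ne_finset_zero fun k hk => if_neg hk
  have hR : HasSum (fun k => if B ≤ k then poissonProb lam k else 0)
      (∑' k, poissonProb lam (k + B)) := by
    rw [← hasSum_nat_add_iff' B, Finset.sum_eq_zero, sub_zero]
    · simpa using (summable_poissonProb_add lam B).hasSum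
    · intro k hk
      rw [if_neg (not_le.2 (Finset.mem_range.1 hk))]
  have hbound (k : ℕ) : ‖g k * poissonProb lam k‖ ≤
      M * ((if k ∈ Finset.range (A + 1) then poissonProb lam k else 0) +
        if B ≤ k then poissonProb lam k else 0) := by
    have hp := poissonProb_nonneg hlam k
    rw [norm_mul, Real.norm_eq_abs, Real.norm_eq_abs, abs_of_nonneg hp]
    by_cases hA : k < A + 1
    · rw [if_pos (Finset.mem_range.2 hA)]
      refine mul_le_mul (hg k) ?_ hp hM
      split_ifs <;> linarith
    · rw [if_neg (by simpa using hA)]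
      by_cases hB : B ≤ k
      · rw [if_pos hB, zero_add]
        exact mul_le_mul_of_nonneg_right (hg k) hp
      · rw [hg0 k (by omega) (by omega), if_neg hB]
        simp
  have hsum := (hL.add hR).mul_left M
  exact ⟨hsum.summable.of_norm_bounded hbound, tsum_of_norm_bounded hsum hbound⟩

theorem szasz_locally_affine_rate_sup (n : ℕ) (hn : 0 < n) (a b x : ℝ)
    (ha : 1 / n ≤ a) (hab : a < b) (hax : a < x) (hxb : x < b)
    (α β : ℝ) (hα : α = (⌊(n : ℝ) * a⌋ : ℝ) / n) (hβ : β = (⌈(n : ℝ) * b⌉ : ℝ) / n)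
    (f ℓ : ℝ → ℝ) (hℓ : ∃ c d : ℝ, ∀ t : ℝ, 0 ≤ t → ℓ t = c * t + d)
    (hfℓ : ∀ t : ℝ, a < t → t < b → f t = ℓ t)
    (M : ℝ) (hM : ∀ t : ℝ, 0 ≤ t → |f t - ℓ t| ≤ M) :
    |szasz n f x - f x| ≤
      M * (Ln n x α * Real.exp (-(n : ℝ) * H α x) + Rn n x β * Real.exp (-(n : ℝ) * H β x)) := by
  have hn' : (0 : ℝ) < n := by exact_mod_cast hn
  have hna : 1 ≤ (n : ℝ) * a := by
    rwa [div_le_iff₀' hn'] at ha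
  have ha0 : 0 < a := (by positivity : (0 : ℝ) < 1 / n).trans_le ha
  have hx0 : 0 < x := ha0.trans hax
  have hlam0 : 0 < (n : ℝ) * x := by positivity
  obtain ⟨A, hA⟩ := Int.eq_ofNat_of_zero_le (Int.floor_nonneg.2 (zero_le_one.trans hna))
  obtain ⟨B, hB⟩ := Int.eq_ofNat_of_zero_le
    (Int.ceil_nonneg (mul_nonneg hn'.le (ha0.trans hab).le))
  have hA1 : 0 < A := by
    have h1 : (1 : ℤ) ≤ ⌊(n : ℝ) * a⌋ := Int.le_floor.2 (by exact_mod_cast hna)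
    omega
  have hAle : (A : ℝ) ≤ n * a := by
    have h1 := Int.floor_le ((n : ℝ) * a)
    rwa [hA] at h1
  have hAlt : (n : ℝ) * a < A + 1 := by
    have h1 := Int.lt_floor_add_one ((n : ℝ) * a)
    rwa [hA] at h1
  have hBle : (n : ℝ) * b ≤ B := by
    have h1 := Int.le_ceil ((n : ℝ) * b)
    rwa [hB] at h1
  have hBlt : (B : ℝ) < n * b + 1 := by
    have h1 := Int.ceil_lt_add_one ((n : ℝ) * b)
    rwa [hB] at h1
  rw [hA, Int.cast_natCast] at hα
  rw [hB, Int.cast_natCast] at hβ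
  have hAx : (A : ℝ) < n * x := hAle.trans_lt (by gcongr)
  have hxB : (n : ℝ) * x < B := lt_of_lt_of_le (by gcongr) hBle
  rw [hα, hβ, neg_mul, neg_mul, mul_H_div hn, mul_H_div hn, Ln_div hn, Rn_div hn]
  obtain ⟨c, d, hcd⟩ := hℓ
  have hM0 : 0 ≤ M := (abs_nonneg _).trans (hM 0 le_rfl)
  have hmem (k : ℕ) : (0 : ℝ) ≤ k / n := by positivity
  obtain ⟨hs, hle⟩ := summable_and_abs_tsum_mul_poissonProb_le hlam0.le (A := A) (B := B)
    (g := fun k : ℕ => f ((k : ℝ) / n) - ℓ ((k : ℝ) / n)) (fun k => hM _ (hmem k)) (by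
      intro k hk hk'
      have h1 : (A : ℝ) + 1 ≤ k := by exact_mod_cast hk
      have h2 : (k : ℝ) + 1 ≤ B := by exact_mod_cast hk'
      refine sub_eq_zero.2 (hfℓ _ ?_ ?_)
      · rw [lt_div_iff₀' hn']
        linarith
      · rw [div_lt_iff₀' hn']
        linarith)
  have hkey : szasz n f x - f x
      = ∑' k : ℕ, (f ((k : ℝ) / n) - ℓ ((k : ℝ) / n)) * poissonProb (n * x) k := by
    have h := hs.hasSum.add (hasSum_affine_mul_poissonProb hn c d x)
    have h' : szasz n f x = ∑' k : ℕ, ((f ((k : ℝ) / n) - ℓ ((k : ℝ) / n)) *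
        poissonProb (n * x) k + (c * ((k : ℝ) / n) + d) * poissonProb (n * x) k) := by
      refine tsum_congr fun k => ?_
      rw [hcd _ (hmem k)]
      ring
    rw [h', h.tsum_eq, hfℓ x hax hxb, hcd x hx0.le, add_sub_cancel_right]
  rw [hkey]
  refine hle.trans (mul_le_mul_of_nonneg_left ?_ hM0)
  exact add_le_add (sum_range_succ_poissonProb_le hA1 hAx) (tsum_poissonProb_add_le hlam0 hxB)
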